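/- arXiv:2309.02236 — 7 statements merged into one kernel-verified Lean document; each statement's English description precedes it below -/
import Mathlib

section
/- Let X be a measurable space, P a probability measure on X, ρ ≥ 0, M ≥ 0, and V : X → ℝ measurable with 0 ≤ V(x) ≤ M for all x. Then lim_{α → 0⁺} ( −α · log ( ∫ exp(−V(x)/α) dP(x) ) − α·ρ ) = essInf_P V. -/
open MeasureTheory

lemma integrable_exp_neg_div {X : Type*} [MeasurableSpace X] {P : Measure X} [IsFiniteMeasure P]
    {V : X → ℝ} (hV : Measurable V) (hV0 : ∀ x, 0 ≤ V x) {α : ℝ} (hα : 0 < α) :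
    Integrable (fun x => Real.exp (-V x / α)) P := by
  refine Integrable.of_bound (by fun_prop) 1 (.of_forall fun x => ?_)
  rw [Real.norm_eq_abs, Real.abs_exp, Real.exp_le_one_iff, neg_div]
  exact neg_nonpos.2 (div_nonneg (hV0 x) hα.le)

/-- An almost-everywhere lower bound of `V` is a lower bound of its soft minimum. -/
lemma le_neg_mul_log_integral_exp {X : Type*} [MeasurableSpace X] {P : Measure X}
    [IsProbabilityMeasure P] {V : X → ℝ} (hV : Measurable V) (hV0 : ∀ x, 0 ≤ V x)
    {α : ℝ} (hα : 0 < α) {m : ℝ} (hm : ∀ᵐ x ∂P, m ≤ V x) :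
    m ≤ -α * Real.log (∫ x, Real.exp (-V x / α) ∂P) := by
  have hint := integrable_exp_neg_div (P := P) hV hV0 hα
  have hle : ∫ x, Real.exp (-V x / α) ∂P ≤ Real.exp (-m / α) := by
    calc _ ≤ ∫ _, Real.exp (-m / α) ∂P := by
          refine integral_mono_ae hint (integrable_const _) ?_
          filter_upwards [hm] with x hx
          gcongr
      _ = _ := by simp
  have hlog := (Real.log_le_iff_le_exp (integral_exp_pos hint)).2 hle
  rw [le_div_iff₀ hα] at hlog
  linarith

/-- The soft minimum of `V` exceeds `t` by at most `-α log P(V < t)`. -/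
lemma neg_mul_log_integral_exp_le {X : Type*} [MeasurableSpace X] {P : Measure X}
    [IsProbabilityMeasure P] {V : X → ℝ} (hV : Measurable V) (hV0 : ∀ x, 0 ≤ V x)
    {α : ℝ} (hα : 0 < α) {t : ℝ} (ht : 0 < P.real {x | V x < t}) :
    -α * Real.log (∫ x, Real.exp (-V x / α) ∂P) ≤ t - α * Real.log (P.real {x | V x < t}) := by
  have hint := integrable_exp_neg_div (P := P) hV hV0 hα
  have hs : MeasurableSet {x | V x < t} := measurableSet_lt hV measurable_const
  have hge : P.real {x | V x < t} * Real.exp (-t / α) ≤ ∫ x, Real.exp (-V x / α) ∂P := by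
    calc _ = ∫ _ in {x | V x < t}, Real.exp (-t / α) ∂P := by simp
      _ ≤ ∫ x in {x | V x < t}, Real.exp (-V x / α) ∂P := by
          refine setIntegral_mono_on (integrable_const _) hint.integrableOn hs fun x hx => ?_
          have hx' : V x ≤ t := le_of_lt hx
          gcongr
      _ ≤ _ := setIntegral_le_integral hint (.of_forall fun x => (Real.exp_pos _).le)
  have hlog := Real.log_le_log (by positivity) hge
  rw [Real.log_mul ht.ne' (Real.exp_pos _).ne', Real.log_exp] at hlog
  have hmul := mul_le_mul_of_nonneg_left hlog hα.le
  rw [mul_add, mul_div_cancel₀ _ hα.ne'] at hmul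
  linarith

theorem stmt_4 {X : Type*} [MeasurableSpace X]
    (P : Measure X) [IsProbabilityMeasure P]
    (ρ : ℝ) (hρ : 0 ≤ ρ) (M : ℝ) (hM : 0 ≤ M)
    (V : X → ℝ) (hV : Measurable V) (hVb : ∀ x, V x ∈ Set.Icc (0 : ℝ) M) :
    Filter.Tendsto
      (fun α : ℝ => -α * Real.log (∫ x, Real.exp (-V x / α) ∂P) - α * ρ)
      (nhdsWithin 0 (Set.Ioi 0)) (nhds (essInf V P)) := by
  have hV0 : ∀ x, 0 ≤ V x := fun x => (hVb x).1
  have hbdd : Filter.IsBoundedUnder (· ≥ ·) (ae P) V := Filter.isBoundedUnder_of ⟨0, hV0⟩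
  have hcobdd : Filter.IsCoboundedUnder (· ≥ ·) (ae P) V :=
    (Filter.isBoundedUnder_of ⟨M, fun x => (hVb x).2⟩ :
      Filter.IsBoundedUnder (· ≤ ·) (ae P) V).isCoboundedUnder_ge
  have hlim (a c : ℝ) : Filter.Tendsto (fun α : ℝ => a - α * c)
      (nhdsWithin 0 (Set.Ioi 0)) (nhds a) := by
    have h : Continuous fun α : ℝ => a - α * c := by fun_prop
    simpa using (h.tendsto 0).mono_left nhdsWithin_le_nhds
  refine tendsto_order.2 ⟨fun a ha => ?_, fun b hb => ?_⟩
  · filter_upwards [(hlim (essInf V P) ρ).eventually (lt_mem_nhds ha), self_mem_nhdsWithin]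
      with α hα hα0
    have h := le_neg_mul_log_integral_exp hV hV0 hα0 (ae_essInf_le hbdd)
    linarith
  · obtain ⟨t, hmt, htb⟩ := exists_between hb
    have ht : 0 < P.real {x | V x < t} := by
      refine measureReal_nonneg.lt_of_ne' fun h0 => hmt.not_ge ?_
      rw [measureReal_eq_zero_iff] at h0
      refine le_essInf_of_ae_le t ?_ hcobdd
      simpa [Filter.EventuallyLE, ae_iff] using h0
    filter_upwards [(hlim t (Real.log (P.real {x | V x < t}))).eventually (gt_mem_nhds htb),
      self_mem_nhdsWithin] with α hα hα0
    have h := neg_mul_log_integral_exp_le hV hV0 hα0 ht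
    have hαρ : 0 ≤ α * ρ := mul_nonneg (le_of_lt hα0) hρ
    linarith
end

section
/- Let X be a measurable space, P a probability measure on X, ρ > 0, M > 0, and V : X → ℝ measurable with 0 ≤ V(x) ≤ M for all x. Then: (a) sup_{α > 0} ( −α · log ( ∫ exp(−V(x)/α) dP(x) ) − α·ρ ) ≥ 0; (b) for every α > M/ρ, one has −α · log ( ∫ exp(−V(x)/α) dP(x) ) − α·ρ ≤ M − α·ρ < 0; consequently the supremum over α > 0 equals the supremum over α ∈ (0, M/ρ]. -/
open MeasureTheory

/-- The log-partition term of the dual objective inherits the bounds `0 ≤ V ≤ M`. -/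
lemma neg_mul_log_integral_exp_mem_Icc {X : Type*} [MeasurableSpace X]
    (P : Measure X) [IsProbabilityMeasure P] {M : ℝ} {V : X → ℝ} (hV : Measurable V)
    (hVb : ∀ x, V x ∈ Set.Icc (0 : ℝ) M) {α : ℝ} (hα : 0 < α) :
    -α * Real.log (∫ x, Real.exp (-V x / α) ∂P) ∈ Set.Icc (0 : ℝ) M := by
  have hle : ∀ x, Real.exp (-V x / α) ≤ 1 := fun x =>
    Real.exp_le_one_iff.2 (div_nonpos_of_nonpos_of_nonneg (neg_nonpos.2 (hVb x).1) hα.le)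
  have hge : ∀ x, Real.exp (-M / α) ≤ Real.exp (-V x / α) := fun x =>
    Real.exp_le_exp.2 (div_le_div_of_nonneg_right (neg_le_neg (hVb x).2) hα.le)
  have hint : Integrable (fun x => Real.exp (-V x / α)) P := by
    refine Integrable.of_bound (C := 1) (by fun_prop) (ae_of_all _ fun x => ?_)
    rw [Real.norm_eq_abs, Real.abs_exp]
    exact hle x
  have hI_le : ∫ x, Real.exp (-V x / α) ∂P ≤ 1 := by
    simpa using integral_mono hint (integrable_const 1) hle
  have hI_ge : Real.exp (-M / α) ≤ ∫ x, Real.exp (-V x / α) ∂P := by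
    simpa using integral_mono (integrable_const (Real.exp (-M / α))) hint hge
  have hI_pos := (Real.exp_pos _).trans_le hI_ge
  have hlog_ge := (Real.le_log_iff_exp_le hI_pos).2 hI_ge
  rw [div_le_iff₀ hα] at hlog_ge
  have hlog_le := Real.log_nonpos hI_pos.le hI_le
  constructor <;> nlinarith

/-- The supremum over `(0, M / ρ]` of a function squeezed between `-α ρ` and `M - α ρ` is
nonnegative. -/
lemma iSup_Ioc_nonneg_of_linear_bounds {f : ℝ → ℝ} {ρ M : ℝ} (hρ : 0 < ρ) (hM : 0 < M)
    (hlower : ∀ α, 0 < α → -(α * ρ) ≤ f α) (hupper : ∀ α, 0 < α → f α ≤ M - α * ρ) :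
    0 ≤ ⨆ α : Set.Ioc (0 : ℝ) (M / ρ), f α := by
  have hbdd : BddAbove (Set.range fun α : Set.Ioc (0 : ℝ) (M / ρ) => f α) := by
    refine ⟨M, ?_⟩
    rintro _ ⟨α, rfl⟩
    have := hupper α α.2.1
    have := mul_pos α.2.1 hρ
    dsimp only
    linarith
  refine le_of_forall_pos_le_add fun ε hε => ?_
  have hmem : min ε M / ρ ∈ Set.Ioc (0 : ℝ) (M / ρ) :=
    ⟨div_pos (lt_min hε hM) hρ, div_le_div_of_nonneg_right (min_le_right _ _) hρ.le⟩
  have hsup := le_ciSup hbdd ⟨_, hmem⟩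
  have hlow := hlower _ hmem.1
  rw [div_mul_cancel₀ _ hρ.ne'] at hlow
  have := min_le_left ε M
  dsimp only at hsup
  linarith

/-- The supremum over all `α > 0` of a function squeezed between `-α ρ` and `M - α ρ`
equals its supremum over `(0, M / ρ]`. -/
lemma iSup_pos_eq_iSup_Ioc_of_linear_bounds {f : ℝ → ℝ} {ρ M : ℝ} (hρ : 0 < ρ) (hM : 0 < M)
    (hlower : ∀ α, 0 < α → -(α * ρ) ≤ f α) (hupper : ∀ α, 0 < α → f α ≤ M - α * ρ) :
    ⨆ α : {a : ℝ // 0 < a}, f α = ⨆ α : Set.Ioc (0 : ℝ) (M / ρ), f α := by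
  have hle : ∀ α, 0 < α → f α ≤ M := fun α hα => by
    linarith [hupper α hα, mul_pos hα hρ]
  have hbdd : BddAbove (Set.range fun α : {a : ℝ // 0 < a} => f α) :=
    ⟨M, by rintro _ ⟨α, rfl⟩; exact hle α α.2⟩
  have hbdd_Ioc : BddAbove (Set.range fun α : Set.Ioc (0 : ℝ) (M / ρ) => f α) :=
    ⟨M, by rintro _ ⟨α, rfl⟩; exact hle α α.2.1⟩
  have : Nonempty {a : ℝ // 0 < a} := ⟨⟨1, one_pos⟩⟩
  have : Nonempty (Set.Ioc (0 : ℝ) (M / ρ)) := ⟨⟨M / ρ, div_pos hM hρ, le_rfl⟩⟩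
  refine le_antisymm (ciSup_le fun α => ?_) (ciSup_le fun α => le_ciSup hbdd ⟨α, α.2.1⟩)
  rcases le_or_gt (α : ℝ) (M / ρ) with h | h
  · exact le_ciSup hbdd_Ioc ⟨α, α.2, h⟩
  · refine le_trans ?_ (iSup_Ioc_nonneg_of_linear_bounds hρ hM hlower hupper)
    rw [div_lt_iff₀ hρ] at h
    linarith [hupper α α.2]

theorem stmt_5 {X : Type*} [MeasurableSpace X]
    (P : Measure X) [IsProbabilityMeasure P]
    (ρ : ℝ) (hρ : 0 < ρ) (M : ℝ) (hM : 0 < M)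
    (V : X → ℝ) (hV : Measurable V) (hVb : ∀ x, V x ∈ Set.Icc (0 : ℝ) M) :
    (0 ≤ ⨆ α : {a : ℝ // 0 < a},
        (-(α : ℝ) * Real.log (∫ x, Real.exp (-V x / (α : ℝ)) ∂P) - (α : ℝ) * ρ)) ∧
    (∀ α : ℝ, M / ρ < α →
        (-α * Real.log (∫ x, Real.exp (-V x / α) ∂P) - α * ρ ≤ M - α * ρ ∧
          M - α * ρ < 0)) ∧
    ((⨆ α : {a : ℝ // 0 < a},
        (-(α : ℝ) * Real.log (∫ x, Real.exp (-V x / (α : ℝ)) ∂P) - (α : ℝ) * ρ)) =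
      ⨆ α : (Set.Ioc (0 : ℝ) (M / ρ)),
        (-(α : ℝ) * Real.log (∫ x, Real.exp (-V x / (α : ℝ)) ∂P) - (α : ℝ) * ρ)) := by
  have hbounds := fun α (hα : 0 < α) => neg_mul_log_integral_exp_mem_Icc P hV hVb hα
  have hlower : ∀ α : ℝ, 0 < α →
      -(α * ρ) ≤ -α * Real.log (∫ x, Real.exp (-V x / α) ∂P) - α * ρ := fun α hα => by
    linarith [(hbounds α hα).1]
  have hupper : ∀ α : ℝ, 0 < α →
      -α * Real.log (∫ x, Real.exp (-V x / α) ∂P) - α * ρ ≤ M - α * ρ := fun α hα =>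
    sub_le_sub_right (hbounds α hα).2 _
  have heq := iSup_pos_eq_iSup_Ioc_of_linear_bounds hρ hM hlower hupper
  refine ⟨?_, fun α hα => ⟨hupper α ((div_pos hM hρ).trans hα), ?_⟩, heq⟩
  · exact heq ▸ iSup_Ioc_nonneg_of_linear_bounds hρ hM hlower hupper
  · exact sub_neg.2 ((div_lt_iff₀ hρ).1 hα)
end

section
/- Let X be a measurable space, P and Q probability measures on X, ρ > 0, 0 < α̲ ≤ ᾱ, M ≥ 0, and V : X → ℝ measurable with 0 ≤ V(x) ≤ M for all x. Then | sup_{α ∈ [α̲, ᾱ]} ( −α log ∫ exp(−V/α) dP − αρ ) − sup_{α ∈ [α̲, ᾱ]} ( −α log ∫ exp(−V/α) dQ − αρ ) | ≤ 2 ᾱ · exp(M/α̲) · sup_{α ∈ [α̲, ᾱ]} | ∫ exp(−V/α) dP − ∫ exp(−V/α) dQ |. -/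
open MeasureTheory

lemma abs_ciSup_sub_ciSup_le {ι : Type*} [Nonempty ι] {f g : ι → ℝ} {C : ℝ}
    (hf : BddAbove (Set.range f)) (hg : BddAbove (Set.range g))
    (h : ∀ i, |f i - g i| ≤ C) : |(⨆ i, f i) - ⨆ i, g i| ≤ C := by
  rw [abs_sub_le_iff, sub_le_iff_le_add, sub_le_iff_le_add]
  constructor
  · refine ciSup_le fun i => ?_
    linarith [(abs_sub_le_iff.1 (h i)).1, le_ciSup hg i]
  · refine ciSup_le fun i => ?_
    linarith [(abs_sub_le_iff.1 (h i)).2, le_ciSup hf i]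

lemma abs_log_sub_log_le {a b c : ℝ} (hc : 0 < c) (ha : c ≤ a) (hb : c ≤ b) :
    |Real.log a - Real.log b| ≤ c⁻¹ * |a - b| := by
  have key : ∀ {x y : ℝ}, c ≤ x → c ≤ y → Real.log x - Real.log y ≤ c⁻¹ * |x - y| := by
    intro x y hx hy
    have hx0 := hc.trans_le hx
    have hy0 := hc.trans_le hy
    calc Real.log x - Real.log y = Real.log (x / y) := (Real.log_div hx0.ne' hy0.ne').symm
      _ ≤ x / y - 1 := Real.log_le_sub_one_of_pos (div_pos hx0 hy0)
      _ = y⁻¹ * (x - y) := by field_simp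
      _ ≤ y⁻¹ * |x - y| := by gcongr; exact le_abs_self _
      _ ≤ c⁻¹ * |x - y| := by gcongr
  rw [abs_sub_le_iff]
  exact ⟨key ha hb, abs_sub_comm a b ▸ key hb ha⟩

lemma integral_exp_neg_div_mem_Icc {X : Type*} [MeasurableSpace X]
    (P : Measure X) [IsProbabilityMeasure P] {l α M : ℝ} (hl : 0 < l) (hα : l ≤ α)
    (hM : 0 ≤ M) {V : X → ℝ} (hV : Measurable V) (hVb : ∀ x, V x ∈ Set.Icc (0 : ℝ) M) :
    ∫ x, Real.exp (-V x / α) ∂P ∈ Set.Icc (Real.exp (-(M / l))) 1 := by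
  have hα0 : 0 < α := hl.trans_le hα
  have hlower : ∀ x, Real.exp (-(M / l)) ≤ Real.exp (-V x / α) := fun x => by
    rw [neg_div]
    have := (hVb x).2
    gcongr
  have hupper : ∀ x, Real.exp (-V x / α) ≤ 1 := fun x => by
    rw [Real.exp_le_one_iff, neg_div, neg_nonpos]
    exact div_nonneg (hVb x).1 hα0.le
  have hint : Integrable (fun x => Real.exp (-V x / α)) P := by
    refine Integrable.of_bound (by fun_prop) 1 (ae_of_all _ fun x => ?_)
    rw [Real.norm_of_nonneg (Real.exp_pos _).le]
    exact hupper x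
  constructor
  · simpa using integral_mono (integrable_const (Real.exp (-(M / l)))) hint hlower
  · simpa using integral_mono hint (integrable_const (1 : ℝ)) hupper

lemma bddAbove_range_neg_mul_log_sub {l u ρ K : ℝ} (hl : 0 < l) (hρ : 0 ≤ ρ) (hK : 0 ≤ K)
    {m : Set.Icc l u → ℝ} (hm : ∀ α, Real.exp (-K) ≤ m α) :
    BddAbove (Set.range fun α : Set.Icc l u => -(α : ℝ) * Real.log (m α) - (α : ℝ) * ρ) := by
  refine ⟨u * K, ?_⟩
  rintro _ ⟨α, rfl⟩
  have hα0 : 0 < (α : ℝ) := hl.trans_le α.2.1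
  have hlog : -K ≤ Real.log (m α) :=
    (Real.le_log_iff_exp_le ((Real.exp_pos _).trans_le (hm α))).2 (hm α)
  have h1 : (α : ℝ) * -Real.log (m α) ≤ α * K := by gcongr; linarith
  have h2 : (α : ℝ) * K ≤ u * K := by gcongr; exact α.2.2
  have h3 : 0 ≤ (α : ℝ) * ρ := by positivity
  simp only
  linarith

theorem stmt_7 {X : Type*} [MeasurableSpace X]
    (P Q : Measure X) [IsProbabilityMeasure P] [IsProbabilityMeasure Q]
    (ρ : ℝ) (hρ : 0 < ρ)
    (l u : ℝ) (hl : 0 < l) (hlu : l ≤ u)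
    (M : ℝ) (hM : 0 ≤ M)
    (V : X → ℝ) (hV : Measurable V) (hVb : ∀ x, V x ∈ Set.Icc (0 : ℝ) M) :
    |(⨆ α : (Set.Icc l u),
        (-(α : ℝ) * Real.log (∫ x, Real.exp (-V x / (α : ℝ)) ∂P) - (α : ℝ) * ρ)) -
      ⨆ α : (Set.Icc l u),
        (-(α : ℝ) * Real.log (∫ x, Real.exp (-V x / (α : ℝ)) ∂Q) - (α : ℝ) * ρ)| ≤
      2 * u * Real.exp (M / l) *
        ⨆ α : (Set.Icc l u),
          |(∫ x, Real.exp (-V x / (α : ℝ)) ∂P) - ∫ x, Real.exp (-V x / (α : ℝ)) ∂Q| := by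
  have : Nonempty (Set.Icc l u) := ⟨⟨l, le_rfl, hlu⟩⟩
  have hP := fun α : Set.Icc l u => integral_exp_neg_div_mem_Icc P hl α.2.1 hM hV hVb
  have hQ := fun α : Set.Icc l u => integral_exp_neg_div_mem_Icc Q hl α.2.1 hM hV hVb
  have hK : 0 ≤ M / l := by positivity
  have hu : 0 < u := hl.trans_le hlu
  have hbdd : BddAbove (Set.range fun α : Set.Icc l u =>
      |(∫ x, Real.exp (-V x / (α : ℝ)) ∂P) - ∫ x, Real.exp (-V x / (α : ℝ)) ∂Q|) := by
    refine ⟨1, ?_⟩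
    rintro _ ⟨α, rfl⟩
    have := Real.exp_pos (-(M / l))
    refine abs_sub_le_iff.2 ⟨?_, ?_⟩ <;> linarith [(hP α).1, (hP α).2, (hQ α).1, (hQ α).2]
  refine abs_ciSup_sub_ciSup_le
    (bddAbove_range_neg_mul_log_sub hl hρ.le hK fun α => (hP α).1)
    (bddAbove_range_neg_mul_log_sub hl hρ.le hK fun α => (hQ α).1) fun α => ?_
  have hα0 : 0 < (α : ℝ) := hl.trans_le α.2.1
  have hsup := le_ciSup hbdd α
  have hlog := abs_log_sub_log_le (Real.exp_pos _) (hP α).1 (hQ α).1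
  rw [← Real.exp_neg, neg_neg] at hlog
  set p := ∫ x, Real.exp (-V x / (α : ℝ)) ∂P
  set q := ∫ x, Real.exp (-V x / (α : ℝ)) ∂Q
  set S := ⨆ α : Set.Icc l u,
    |(∫ x, Real.exp (-V x / (α : ℝ)) ∂P) - ∫ x, Real.exp (-V x / (α : ℝ)) ∂Q|
  have hS : 0 ≤ S := (abs_nonneg _).trans hsup
  calc |(-(α : ℝ) * Real.log p - α * ρ) - (-(α : ℝ) * Real.log q - α * ρ)|
      = α * |Real.log p - Real.log q| := by
        rw [← abs_of_pos hα0, ← abs_mul, abs_of_pos hα0, ← abs_neg]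
        congr 1
        ring
    _ ≤ u * (Real.exp (M / l) * S) := by
        gcongr
        · exact α.2.2
        · exact hlog.trans (by gcongr)
    _ ≤ 2 * u * Real.exp (M / l) * S := by
        have : 0 ≤ u * (Real.exp (M / l) * S) := by positivity
        linarith
end

section
/- Let S be a measurable space, A a set (of actions), r : S × A → [0, 1], γ ∈ (0, 1), π : S → A a policy, and for i = 1, 2 let 𝒫ᵢ(s, a) be a nonempty set of probability measures on S for every (s, a). Suppose V₁, V₂ : S → ℝ are bounded measurable functions satisfying the robust Bellman fixed-point equations Vᵢ(s) = r(s, π(s)) + γ · inf_{p ∈ 𝒫ᵢ(s, π(s))} ∫ Vᵢ dp for all s ∈ S and i = 1, 2. Then sup_{s ∈ S} |V₁(s) − V₂(s)| ≤ (γ / (1 − γ)) · sup_{s ∈ S} | inf_{p ∈ 𝒫₁(s, π(s))} ∫ V₁ dp − inf_{p ∈ 𝒫₂(s, π(s))} ∫ V₁ dp |. -/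
open MeasureTheory

lemma abs_integral_le_of_forall_abs_le {S : Type*} [MeasurableSpace S] (p : Measure S)
    [IsProbabilityMeasure p] {f : S → ℝ} {C : ℝ} (hf : ∀ s, |f s| ≤ C) :
    |∫ s, f s ∂p| ≤ C := by
  simpa using norm_integral_le_of_norm_le_const (μ := p) (f := f) (C := C)
    (Filter.Eventually.of_forall hf)

lemma integrable_of_measurable_of_forall_abs_le {S : Type*} [MeasurableSpace S] (p : Measure S)
    [IsFiniteMeasure p] {f : S → ℝ} {C : ℝ} (hm : Measurable f) (hf : ∀ s, |f s| ≤ C) :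
    Integrable f p :=
  Integrable.of_bound hm.aestronglyMeasurable C (Filter.Eventually.of_forall hf)

lemma abs_ciInf_sub_ciInf_le {ι : Type*} [Nonempty ι] {f g : ι → ℝ} {D : ℝ}
    (hf : BddBelow (Set.range f)) (hg : BddBelow (Set.range g)) (h : ∀ i, |f i - g i| ≤ D) :
    |(⨅ i, f i) - ⨅ i, g i| ≤ D := by
  have h₁ : (⨅ i, f i) - D ≤ ⨅ i, g i := le_ciInf fun i => by
    linarith [ciInf_le hf i, (abs_le.1 (h i)).2]
  have h₂ : (⨅ i, g i) - D ≤ ⨅ i, f i := le_ciInf fun i => by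
    linarith [ciInf_le hg i, (abs_le.1 (h i)).1]
  exact abs_le.2 ⟨by linarith, by linarith⟩

section RobustExpectation

variable {S : Type*} [MeasurableSpace S] {U : Set (Measure S)}

lemma bddBelow_range_integral (hp : ∀ p ∈ U, IsProbabilityMeasure p)
    {f : S → ℝ} {C : ℝ} (hf : ∀ s, |f s| ≤ C) :
    BddBelow (Set.range fun p : U => ∫ s, f s ∂(p : Measure S)) := by
  refine ⟨-C, ?_⟩
  rintro _ ⟨p, rfl⟩
  have := hp p p.2
  exact (abs_le.1 (abs_integral_le_of_forall_abs_le (p : Measure S) hf)).1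

lemma abs_iInf_integral_le (hU : U.Nonempty) (hp : ∀ p ∈ U, IsProbabilityMeasure p)
    {f : S → ℝ} {C : ℝ} (hf : ∀ s, |f s| ≤ C) :
    |⨅ p : U, ∫ s, f s ∂(p : Measure S)| ≤ C := by
  have := hU.to_subtype
  have h := abs_ciInf_sub_ciInf_le (g := fun _ : U => (0 : ℝ)) (D := C)
    (bddBelow_range_integral hp hf) ⟨0, by rintro _ ⟨_, rfl⟩; exact le_rfl⟩ fun p => by
      have := hp p p.2
      simpa using abs_integral_le_of_forall_abs_le (p : Measure S) hf
  simpa using h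

lemma abs_iInf_integral_sub_le (hU : U.Nonempty) (hp : ∀ p ∈ U, IsProbabilityMeasure p)
    {f g : S → ℝ} {C C' D : ℝ} (hfm : Measurable f) (hgm : Measurable g)
    (hf : ∀ s, |f s| ≤ C) (hg : ∀ s, |g s| ≤ C') (h : ∀ s, |f s - g s| ≤ D) :
    |(⨅ p : U, ∫ s, f s ∂(p : Measure S)) - ⨅ p : U, ∫ s, g s ∂(p : Measure S)| ≤ D := by
  have := hU.to_subtype
  refine abs_ciInf_sub_ciInf_le (bddBelow_range_integral hp hf)
    (bddBelow_range_integral hp hg) fun p => ?_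
  have := hp p p.2
  rw [← integral_sub (integrable_of_measurable_of_forall_abs_le _ hfm hf)
    (integrable_of_measurable_of_forall_abs_le _ hgm hg)]
  exact abs_integral_le_of_forall_abs_le (p : Measure S) h

end RobustExpectation

theorem stmt_8 {S : Type*} [MeasurableSpace S] {A : Type*}
    (r : S → A → ℝ) (hr : ∀ s a, r s a ∈ Set.Icc (0 : ℝ) 1)
    (γ : ℝ) (hγ : γ ∈ Set.Ioo (0 : ℝ) 1)
    (π : S → A)
    (U₁ U₂ : S → A → Set (Measure S))
    (hU₁ne : ∀ s a, (U₁ s a).Nonempty) (hU₂ne : ∀ s a, (U₂ s a).Nonempty)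
    (hU₁p : ∀ s a, ∀ p ∈ U₁ s a, IsProbabilityMeasure p)
    (hU₂p : ∀ s a, ∀ p ∈ U₂ s a, IsProbabilityMeasure p)
    (V₁ V₂ : S → ℝ) (hm₁ : Measurable V₁) (hm₂ : Measurable V₂)
    (C₁ C₂ : ℝ) (hb₁ : ∀ s, |V₁ s| ≤ C₁) (hb₂ : ∀ s, |V₂ s| ≤ C₂)
    (hBell₁ : ∀ s, V₁ s =
      r s (π s) + γ * ⨅ p : (U₁ s (π s)), ∫ s', V₁ s' ∂(p : Measure S))
    (hBell₂ : ∀ s, V₂ s =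
      r s (π s) + γ * ⨅ p : (U₂ s (π s)), ∫ s', V₂ s' ∂(p : Measure S)) :
    (⨆ s, |V₁ s - V₂ s|) ≤ (γ / (1 - γ)) *
      ⨆ s, |(⨅ p : (U₁ s (π s)), ∫ s', V₁ s' ∂(p : Measure S)) -
             ⨅ p : (U₂ s (π s)), ∫ s', V₁ s' ∂(p : Measure S)| := by
  obtain ⟨hγ0, hγ1⟩ := hγ
  rcases isEmpty_or_nonempty S with hS | hS
  · simp [Real.iSup_of_isEmpty]
  set E : S → ℝ := fun s => |(⨅ p : (U₁ s (π s)), ∫ s', V₁ s' ∂(p : Measure S)) -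
    ⨅ p : (U₂ s (π s)), ∫ s', V₁ s' ∂(p : Measure S)|
  have hbddV : BddAbove (Set.range fun s => |V₁ s - V₂ s|) := by
    refine ⟨C₁ + C₂, ?_⟩
    rintro _ ⟨s, rfl⟩
    exact (abs_sub _ _).trans (add_le_add (hb₁ s) (hb₂ s))
  have hbddE : BddAbove (Set.range E) := by
    refine ⟨C₁ + C₁, ?_⟩
    rintro _ ⟨s, rfl⟩
    exact (abs_sub _ _).trans (add_le_add
      (abs_iInf_integral_le (hU₁ne s _) (hU₁p s _) hb₁)
      (abs_iInf_integral_le (hU₂ne s _) (hU₂p s _) hb₁))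
  have key : (⨆ s, |V₁ s - V₂ s|) ≤ γ * ((⨆ s, E s) + ⨆ s, |V₁ s - V₂ s|) := by
    refine ciSup_le fun s => ?_
    have hV := abs_iInf_integral_sub_le (hU₂ne s (π s)) (hU₂p s (π s)) hm₁ hm₂ hb₁ hb₂
      (le_ciSup hbddV)
    rw [hBell₁ s, hBell₂ s, add_sub_add_left_eq_sub, ← mul_sub, abs_mul, abs_of_pos hγ0]
    exact mul_le_mul_of_nonneg_left
      ((abs_sub_le _ _ _).trans (add_le_add (le_ciSup hbddE s) hV)) hγ0.le
  rw [div_mul_eq_mul_div, le_div_iff₀ (sub_pos.2 hγ1)]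
  linarith
end

section
/- Let X be a measurable space, P a probability measure on X, η ≥ 0, and let V, V' : X → [0, ∞) be bounded measurable functions. Then | ∫ (η − V'(x))₊² dP(x) − ∫ (η − V(x))₊² dP(x) | ≤ 2 · (sup_x |V'(x) − V(x)|)² + 2η · sup_x |V'(x) − V(x)|. -/
open MeasureTheory

lemma abs_sq_max_sub_sq_max_le {η u v : ℝ} (hη : 0 ≤ η) (hu : 0 ≤ u) (hv : 0 ≤ v) :
    |max (η - u) 0 ^ 2 - max (η - v) 0 ^ 2| ≤ 2 * η * |u - v| := by
  have hsub : |max (η - u) 0 - max (η - v) 0| ≤ |u - v| := by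
    have h := abs_max_sub_max_le_abs (η - u) (η - v) 0
    rwa [sub_sub_sub_cancel_left, abs_sub_comm v u] at h
  have hadd : |max (η - u) 0 + max (η - v) 0| ≤ 2 * η := by
    rw [abs_of_nonneg (by positivity)]
    linarith [max_le (sub_le_self η hu) hη, max_le (sub_le_self η hv) hη]
  rw [sq_sub_sq, abs_mul]
  gcongr

lemma integrable_sq_max_const_sub {X : Type*} [MeasurableSpace X] {P : Measure X}
    [IsFiniteMeasure P] {η : ℝ} (hη : 0 ≤ η) {V : X → ℝ} (hV : Measurable V)
    (hVpos : ∀ x, 0 ≤ V x) : Integrable (fun x => max (η - V x) 0 ^ 2) P := by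
  refine Integrable.of_bound (C := η ^ 2) (by fun_prop) (ae_of_all _ fun x => ?_)
  rw [Real.norm_of_nonneg (by positivity)]
  gcongr
  exact max_le (sub_le_self η (hVpos x)) hη

theorem stmt_13 {X : Type*} [MeasurableSpace X]
    (P : Measure X) [IsProbabilityMeasure P]
    (η : ℝ) (hη : 0 ≤ η)
    (V V' : X → ℝ) (hV : Measurable V) (hV' : Measurable V')
    (hVpos : ∀ x, 0 ≤ V x) (hV'pos : ∀ x, 0 ≤ V' x)
    (C C' : ℝ) (hVb : ∀ x, V x ≤ C) (hV'b : ∀ x, V' x ≤ C') :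
    |(∫ x, max (η - V' x) 0 ^ 2 ∂P) - ∫ x, max (η - V x) 0 ^ 2 ∂P| ≤
      2 * (⨆ x, |V' x - V x|) ^ 2 + 2 * η * ⨆ x, |V' x - V x| := by
  have hbdd : BddAbove (Set.range fun x => |V' x - V x|) := by
    refine ⟨max C C', ?_⟩
    rintro _ ⟨x, rfl⟩
    refine abs_le.2 ⟨?_, ?_⟩
    · linarith [hVb x, hV'pos x, le_max_left C C']
    · linarith [hV'b x, hVpos x, le_max_right C C']
  have hpt : ∀ x, ‖max (η - V' x) 0 ^ 2 - max (η - V x) 0 ^ 2‖ ≤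
      2 * η * ⨆ x, |V' x - V x| := fun x =>
    (abs_sq_max_sub_sq_max_le hη (hV'pos x) (hVpos x)).trans
      (mul_le_mul_of_nonneg_left (le_ciSup hbdd x) (by positivity))
  have h := norm_integral_le_of_norm_le_const (ae_of_all P hpt)
  rw [integral_sub (integrable_sq_max_const_sub hη hV' hV'pos)
    (integrable_sq_max_const_sub hη hV hVpos), probReal_univ, mul_one, Real.norm_eq_abs] at h
  exact h.trans (le_add_of_nonneg_left (by positivity))
end

section
/- Let d ≥ 1, σ > 0, μ₁, μ₂ ∈ ℝ^d, ρ > 0, M > 0, and let V : ℝ^d → ℝ be measurable with 0 ≤ V(x) ≤ M for all x. Write c = √(1 + 2ρ) and B = cM/(c − 1), and let η ∈ [0, B]. Then | ∫ (η − V)₊² dN(μ₁, σ²I) − ∫ (η − V)₊² dN(μ₂, σ²I) | ≤ B² · ‖μ₁ − μ₂‖ / σ. -/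
open MeasureTheory

/-- The isotropic Gaussian measure `N(μ, σ²I)` on `ℝ^d`, as the product over coordinates
of one-dimensional Gaussian measures with mean `μ i` and variance `σ²`. -/
noncomputable def gaussPi {d : ℕ} (μ : Fin d → ℝ) (σ : ℝ) : Measure (Fin d → ℝ) :=
  Measure.pi fun i => ProbabilityTheory.gaussianReal (μ i) ⟨σ ^ 2, sq_nonneg σ⟩

/-- A finite product of measures with integrable densities has the product density. -/
theorem Measure.pi_withDensity_ofReal {ι : Type*} [Fintype ι] {E : ι → Type*}
    {mE : ∀ i, MeasurableSpace (E i)} (μ : ∀ i, Measure (E i)) [∀ i, SigmaFinite (μ i)]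
    {f : ∀ i, E i → ℝ} (hf : ∀ i, Integrable (f i) (μ i)) (hf0 : ∀ i x, 0 ≤ f i x)
    [∀ i, SigmaFinite ((μ i).withDensity fun x => ENNReal.ofReal (f i x))] :
    Measure.pi (fun i => (μ i).withDensity fun x => ENNReal.ofReal (f i x)) =
      (Measure.pi μ).withDensity fun x => ENNReal.ofReal (∏ i, f i (x i)) := by
  refine Measure.pi_eq fun s hs => ?_
  rw [withDensity_apply _ (MeasurableSet.univ_pi hs), Measure.restrict_pi_pi,
    ← ofReal_integral_eq_lintegral_ofReal
      (Integrable.fintype_prod_dep fun i => (hf i).restrict)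
      (Filter.Eventually.of_forall fun x => Finset.prod_nonneg fun i _ => hf0 i _),
    integral_fintype_prod_eq_prod,
    ENNReal.ofReal_prod_of_nonneg fun i _ => integral_nonneg (hf0 i)]
  refine Finset.prod_congr rfl fun i _ => ?_
  rw [withDensity_apply _ (hs i), ofReal_integral_eq_lintegral_ofReal (hf i).restrict
    (Filter.Eventually.of_forall (hf0 i))]

/-- The likelihood ratio of `N(a, v)` with respect to `N(b, v)`. -/
noncomputable def gaussRatio (a b v x : ℝ) : ℝ :=
  Real.exp ((a - b) / v * x) * Real.exp ((b ^ 2 - a ^ 2) / (2 * v))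

theorem gaussRatio_pos (a b v x : ℝ) : 0 < gaussRatio a b v x :=
  mul_pos (Real.exp_pos _) (Real.exp_pos _)

theorem measurable_gaussRatio (a b v : ℝ) : Measurable (gaussRatio a b v) := by
  unfold gaussRatio
  fun_prop

theorem integrable_gaussRatio (a b : ℝ) (v : NNReal) :
    Integrable (gaussRatio a b v) (ProbabilityTheory.gaussianReal b v) :=
  (ProbabilityTheory.integrable_exp_mul_gaussianReal _).mul_const _

theorem gaussianReal_eq_withDensity_gaussRatio (a b : ℝ) {v : NNReal} (hv : v ≠ 0) :
    ProbabilityTheory.gaussianReal a v = (ProbabilityTheory.gaussianReal b v).withDensity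
      fun x => ENNReal.ofReal (gaussRatio a b v x) := by
  have hv' : (v : ℝ) ≠ 0 := by exact_mod_cast hv
  rw [ProbabilityTheory.gaussianReal_of_var_ne_zero _ hv,
    ProbabilityTheory.gaussianReal_of_var_ne_zero _ hv,
    ← withDensity_mul _ (ProbabilityTheory.measurable_gaussianPDF _ _)
      (measurable_gaussRatio _ _ _).ennreal_ofReal]
  congr 1
  ext x
  rw [Pi.mul_apply, ProbabilityTheory.gaussianPDF, ProbabilityTheory.gaussianPDF,
    ← ENNReal.ofReal_mul (ProbabilityTheory.gaussianPDFReal_nonneg _ _ _)]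
  congr 1
  rw [ProbabilityTheory.gaussianPDFReal, ProbabilityTheory.gaussianPDFReal, gaussRatio,
    ← Real.exp_add, mul_assoc (√_)⁻¹, ← Real.exp_add]
  congr 2
  field_simp
  ring

theorem gaussRatio_sq (a b v x : ℝ) :
    gaussRatio a b v x ^ 2 =
      Real.exp (2 * (a - b) / v * x) * Real.exp ((b ^ 2 - a ^ 2) / v) := by
  rw [gaussRatio, mul_pow, ← Real.exp_nat_mul, ← Real.exp_nat_mul]
  congr 2 <;> push_cast
  · ring
  · by_cases hv : v = 0
    · simp [hv]
    · field_simp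

theorem integrable_gaussRatio_sq (a b : ℝ) (v : NNReal) :
    Integrable (fun x => gaussRatio a b v x ^ 2) (ProbabilityTheory.gaussianReal b v) := by
  simp_rw [gaussRatio_sq]
  exact (ProbabilityTheory.integrable_exp_mul_gaussianReal _).mul_const _

theorem integral_gaussRatio_sq (a b : ℝ) {v : NNReal} (hv : v ≠ 0) :
    ∫ x, gaussRatio a b v x ^ 2 ∂(ProbabilityTheory.gaussianReal b v) =
      Real.exp ((a - b) ^ 2 / v) := by
  have hv' : (v : ℝ) ≠ 0 := by exact_mod_cast hv
  have h := congrFun (ProbabilityTheory.mgf_id_gaussianReal (μ := b) (v := v)) (2 * (a - b) / v)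
  simp only [ProbabilityTheory.mgf, id] at h
  simp_rw [gaussRatio_sq]
  rw [integral_mul_const, h, ← Real.exp_add]
  congr 1
  field_simp
  ring

/-- Bound on the difference of expectations of a function with values in `[0, 2 * K]` by the
chi-square divergence. -/
theorem abs_integral_withDensity_sub_le {Ω : Type*} [MeasurableSpace Ω] (Q : Measure Ω)
    [IsProbabilityMeasure Q] {L f : Ω → ℝ} {K : ℝ} (hLm : Measurable L) (hL0 : ∀ x, 0 ≤ L x)
    (hL : Integrable L Q) (hL2 : Integrable (fun x => L x ^ 2) Q) (hL1 : ∫ x, L x ∂Q = 1)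
    (hf : Measurable f) (hfK : ∀ x, f x ∈ Set.Icc 0 (2 * K)) :
    |∫ x, f x ∂(Q.withDensity fun x => ENNReal.ofReal (L x)) - ∫ x, f x ∂Q| ≤
      K * √(∫ x, L x ^ 2 ∂Q - 1) := by
  have hfb : ∀ x, |f x - K| ≤ K := fun x => by
    rw [abs_le]
    constructor <;> linarith [(hfK x).1, (hfK x).2]
  have hK : 0 ≤ K := by
    obtain ⟨x⟩ := nonempty_of_isProbabilityMeasure Q
    exact (abs_nonneg _).trans (hfb x)
  have hfn : ∀ x, ‖f x‖ ≤ 2 * K := fun x => by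
    rw [Real.norm_of_nonneg (hfK x).1]
    exact (hfK x).2
  have hfi : Integrable f Q :=
    Integrable.of_bound hf.aestronglyMeasurable (2 * K) (Filter.Eventually.of_forall hfn)
  have hLf : Integrable (fun x => L x * f x) Q :=
    hL.mul_bdd hf.aestronglyMeasurable (Filter.Eventually.of_forall hfn)
  have hP : ∫ x, f x ∂(Q.withDensity fun x => ENNReal.ofReal (L x)) = ∫ x, L x * f x ∂Q := by
    rw [integral_withDensity_eq_integral_toReal_smul hLm.ennreal_ofReal (by simp)]
    simp [ENNReal.toReal_ofReal (hL0 _)]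
  have hsub : Integrable (fun x => L x - 1) Q := hL.sub (integrable_const _)
  have hdiff : ∫ x, L x * f x ∂Q - ∫ x, f x ∂Q = ∫ x, (f x - K) * (L x - 1) ∂Q := by
    have h0 : ∫ x, (L x - 1) ∂Q = 0 := by
      rw [integral_sub hL (integrable_const _), hL1]
      simp
    have h1 : ∀ x, (f x - K) * (L x - 1) = (L x * f x - f x) - K * (L x - 1) := fun x => by ring
    simp_rw [h1]
    have hLff : Integrable (fun x => L x * f x - f x) Q := hLf.sub hfi
    rw [integral_sub hLff (hsub.const_mul K), integral_sub hLf hfi, integral_const_mul, h0]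
    simp
  have hexp : ∀ x, |L x - 1| ^ 2 = L x ^ 2 - 2 * L x + 1 := fun x => by
    rw [sq_abs]
    ring
  have hL2L : Integrable (fun x => L x ^ 2 - 2 * L x) Q := hL2.sub (hL.const_mul 2)
  have hsq : Integrable (fun x => |L x - 1| ^ 2) Q := by
    simp_rw [hexp]
    exact hL2L.add (integrable_const _)
  have hsqi : ∫ x, |L x - 1| ^ 2 ∂Q = ∫ x, L x ^ 2 ∂Q - 1 := by
    simp_rw [hexp]
    rw [integral_add hL2L (integrable_const _),
      integral_sub hL2 (hL.const_mul 2), integral_const_mul, hL1]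
    simp
    ring
  have hmem : MemLp (fun x => |L x - 1|) 2 Q :=
    (memLp_two_iff_integrable_sq (by fun_prop)).2 hsq
  have hvar := ProbabilityTheory.variance_nonneg (fun x => |L x - 1|) Q
  rw [ProbabilityTheory.variance_eq_sub hmem] at hvar
  simp only [Pi.pow_apply, hsqi] at hvar
  rw [hP, hdiff]
  calc |∫ x, (f x - K) * (L x - 1) ∂Q| ≤ ∫ x, |(f x - K) * (L x - 1)| ∂Q :=
        abs_integral_le_integral_abs
    _ ≤ ∫ x, K * |L x - 1| ∂Q := by
        refine integral_mono_of_nonneg (Filter.Eventually.of_forall fun x => abs_nonneg _)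
          (hsub.abs.const_mul K) (Filter.Eventually.of_forall fun x => ?_)
        simp only [abs_mul]
        exact mul_le_mul_of_nonneg_right (hfb x) (abs_nonneg _)
    _ = K * ∫ x, |L x - 1| ∂Q := integral_const_mul _ _
    _ ≤ _ := mul_le_mul_of_nonneg_left (Real.le_sqrt_of_sq_le (by linarith)) hK

theorem gaussPi_eq_pi_toNNReal {d : ℕ} (μ : Fin d → ℝ) (σ : ℝ) :
    gaussPi μ σ = Measure.pi fun i =>
      ProbabilityTheory.gaussianReal (μ i) (σ ^ 2).toNNReal := by
  rw [Real.toNNReal_of_nonneg (sq_nonneg σ)]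
  rfl

instance {d : ℕ} (μ : Fin d → ℝ) (σ : ℝ) : IsProbabilityMeasure (gaussPi μ σ) := by
  rw [gaussPi_eq_pi_toNNReal]
  infer_instance

theorem abs_integral_gaussPi_sub_le {d : ℕ} {σ : ℝ} (hσ : 0 < σ) (μ₁ μ₂ : Fin d → ℝ)
    {f : (Fin d → ℝ) → ℝ} {K : ℝ} (hf : Measurable f) (hfK : ∀ x, f x ∈ Set.Icc 0 (2 * K)) :
    |∫ x, f x ∂(gaussPi μ₁ σ) - ∫ x, f x ∂(gaussPi μ₂ σ)| ≤
      K * √(Real.exp ((∑ i, (μ₁ i - μ₂ i) ^ 2) / σ ^ 2) - 1) := by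
  set v : NNReal := (σ ^ 2).toNNReal with hv_def
  have hvσ : (v : ℝ) = σ ^ 2 := Real.coe_toNNReal _ (sq_nonneg σ)
  have hv : v ≠ 0 := by
    rw [← NNReal.coe_ne_zero, hvσ]
    positivity
  set L : (Fin d → ℝ) → ℝ := fun x => ∏ i, gaussRatio (μ₁ i) (μ₂ i) v (x i) with hL_def
  have hLm : Measurable L :=
    Finset.measurable_prod _ fun i _ => (measurable_gaussRatio _ _ _).comp (measurable_pi_apply i)
  have hL0 : ∀ x, 0 ≤ L x := fun x => Finset.prod_nonneg fun i _ => (gaussRatio_pos _ _ _ _).le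
  have hL : Integrable L (gaussPi μ₂ σ) := by
    rw [gaussPi_eq_pi_toNNReal]
    exact Integrable.fintype_prod_dep fun i => integrable_gaussRatio (μ₁ i) (μ₂ i) v
  have hLsq : ∀ x, L x ^ 2 = ∏ i, gaussRatio (μ₁ i) (μ₂ i) v (x i) ^ 2 := fun x =>
    (Finset.prod_pow _ _ _).symm
  have hL2 : Integrable (fun x => L x ^ 2) (gaussPi μ₂ σ) := by
    simp_rw [hLsq]
    rw [gaussPi_eq_pi_toNNReal]
    exact Integrable.fintype_prod_dep
      (f := fun i t => gaussRatio (μ₁ i) (μ₂ i) v t ^ 2)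
      fun i => integrable_gaussRatio_sq (μ₁ i) (μ₂ i) v
  have hint : ∫ x, L x ^ 2 ∂(gaussPi μ₂ σ) =
      Real.exp ((∑ i, (μ₁ i - μ₂ i) ^ 2) / σ ^ 2) := by
    simp_rw [hLsq]
    rw [gaussPi_eq_pi_toNNReal,
      integral_fintype_prod_eq_prod (fun i t => gaussRatio (μ₁ i) (μ₂ i) v t ^ 2)]
    simp_rw [← hv_def, integral_gaussRatio_sq _ _ hv]
    rw [← Real.exp_sum, Finset.sum_div, hvσ]
  have hP : gaussPi μ₁ σ = (gaussPi μ₂ σ).withDensity fun x => ENNReal.ofReal (L x) := by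
    have hd : ∀ i, ProbabilityTheory.gaussianReal (μ₁ i) v = _ := fun i =>
      gaussianReal_eq_withDensity_gaussRatio (μ₁ i) (μ₂ i) hv
    have : ∀ i, SigmaFinite ((ProbabilityTheory.gaussianReal (μ₂ i) v).withDensity
        fun x => ENNReal.ofReal (gaussRatio (μ₁ i) (μ₂ i) v x)) := fun i => by
      rw [← hd i]
      infer_instance
    rw [gaussPi_eq_pi_toNNReal, gaussPi_eq_pi_toNNReal, ← hv_def, funext hd]
    exact Measure.pi_withDensity_ofReal _ (fun i => integrable_gaussRatio (μ₁ i) (μ₂ i) v)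
      fun i x => (gaussRatio_pos _ _ _ _).le
  have hL1 : ∫ x, L x ∂(gaussPi μ₂ σ) = 1 := by
    have h1 : (gaussPi μ₁ σ) Set.univ = 1 := measure_univ
    rw [hP, withDensity_apply _ MeasurableSet.univ, Measure.restrict_univ,
      ← ofReal_integral_eq_lintegral_ofReal hL (Filter.Eventually.of_forall hL0)] at h1
    exact ENNReal.ofReal_eq_one.1 h1
  rw [hP, ← hint]
  exact abs_integral_withDensity_sub_le _ hLm hL0 hL hL2 hL1 hf hfK

theorem sqrt_exp_sq_sub_one_le {s : ℝ} (hs0 : 0 ≤ s) (hs : s ≤ 1) :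
    √(Real.exp (s ^ 2) - 1) ≤ 2 * s := by
  refine Real.sqrt_le_iff.2 ⟨by positivity, ?_⟩
  have h2 : |s ^ 2| ≤ 1 := by
    rw [abs_of_nonneg (sq_nonneg s)]
    nlinarith
  have h := (abs_le.1 (Real.abs_exp_sub_one_le h2)).2
  rw [abs_of_nonneg (sq_nonneg s)] at h
  nlinarith

theorem stmt_14 {d : ℕ} (hd : 1 ≤ d) (σ : ℝ) (hσ : 0 < σ) (μ₁ μ₂ : Fin d → ℝ)
    (ρ : ℝ) (hρ : 0 < ρ) (M : ℝ) (hM : 0 < M)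
    (V : (Fin d → ℝ) → ℝ) (hV : Measurable V) (hVb : ∀ x, V x ∈ Set.Icc (0 : ℝ) M)
    (η : ℝ)
    (hη : η ∈ Set.Icc (0 : ℝ)
      (Real.sqrt (1 + 2 * ρ) * M / (Real.sqrt (1 + 2 * ρ) - 1))) :
    |(∫ x, max (η - V x) 0 ^ 2 ∂(gaussPi μ₁ σ)) -
        ∫ x, max (η - V x) 0 ^ 2 ∂(gaussPi μ₂ σ)| ≤
      (Real.sqrt (1 + 2 * ρ) * M / (Real.sqrt (1 + 2 * ρ) - 1)) ^ 2 *
        (Real.sqrt (∑ i, (μ₁ i - μ₂ i) ^ 2) / σ) := by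
  set B := Real.sqrt (1 + 2 * ρ) * M / (Real.sqrt (1 + 2 * ρ) - 1)
  obtain ⟨hη0, hηB⟩ := hη
  have hS : 0 ≤ ∑ i, (μ₁ i - μ₂ i) ^ 2 := Finset.sum_nonneg fun i _ => sq_nonneg _
  set s := Real.sqrt (∑ i, (μ₁ i - μ₂ i) ^ 2) / σ with hs_def
  have hs0 : 0 ≤ s := by positivity
  have hf0 : ∀ x, 0 ≤ max (η - V x) 0 ^ 2 := fun x => sq_nonneg _
  have hfB : ∀ x, max (η - V x) 0 ^ 2 ≤ B ^ 2 := fun x =>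
    pow_le_pow_left₀ (le_max_right _ _)
      (max_le (by linarith [(hVb x).1]) (hη0.trans hηB)) 2
  rcases le_or_gt s 1 with hs | hs
  · have h := abs_integral_gaussPi_sub_le hσ μ₁ μ₂ (f := fun x => max (η - V x) 0 ^ 2)
      (K := B ^ 2 / 2) (by fun_prop) fun x => ⟨hf0 x, by linarith [hfB x]⟩
    have hss : (∑ i, (μ₁ i - μ₂ i) ^ 2) / σ ^ 2 = s ^ 2 := by
      rw [hs_def, div_pow, Real.sq_sqrt hS]
    rw [hss] at h
    calc _ ≤ _ := h
      _ ≤ B ^ 2 / 2 * (2 * s) :=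
        mul_le_mul_of_nonneg_left (sqrt_exp_sq_sub_one_le hs0 hs) (by positivity)
      _ = B ^ 2 * s := by ring
  · have hle : ∀ μ : Fin d → ℝ, ∫ x, max (η - V x) 0 ^ 2 ∂(gaussPi μ σ) ≤ B ^ 2 := fun μ =>
      (integral_mono_of_nonneg (Filter.Eventually.of_forall hf0) (integrable_const (B ^ 2))
        (Filter.Eventually.of_forall hfB)).trans (by simp)
    have hge : ∀ μ : Fin d → ℝ, 0 ≤ ∫ x, max (η - V x) 0 ^ 2 ∂(gaussPi μ σ) := fun μ =>
      integral_nonneg hf0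
    have hB : B ^ 2 ≤ B ^ 2 * s := le_mul_of_one_le_right (sq_nonneg B) hs.le
    rw [abs_le]
    constructor <;> linarith [hle μ₁, hle μ₂, hge μ₁, hge μ₂]
end

section
/- Let d ≥ 1, σ > 0, μ₁, μ₂ ∈ ℝ^d, ρ > 0, γ ∈ (0, 1), and let V : ℝ^d → ℝ be measurable with 0 ≤ V(x) ≤ 1/(1 − γ) for all x. Write P = N(μ₁, σ²I) and Q = N(μ₂, σ²I). Then | inf_{p ≪ P, TV(p, P) ≤ ρ} ∫ V dp − inf_{p ≪ Q, TV(p, Q) ≤ ρ} ∫ V dp | ≤ sup_{η ∈ [0, (2 + ρ)/(ρ(1 − γ))]} | ∫ (η − V)₊ dP − ∫ (η − V)₊ dQ |, where each infimum is over probability measures p on ℝ^d absolutely continuous with respect to the indicated nominal Gaussian measure and within total-variation distance ρ of it. -/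
open MeasureTheory

/-- Total-variation distance between two measures:
the supremum over measurable sets `A` of `|P A − Q A|`. -/
noncomputable def TVdist {X : Type*} [MeasurableSpace X] (P Q : Measure X) : ℝ :=
  ⨆ A : {A : Set X // MeasurableSet A}, |(P A).toReal - (Q A).toReal|

open Set Filter

theorem absolutelyContinuous_pi_fin :
    ∀ {n : ℕ} {P Q : Fin n → Measure ℝ} [∀ i, SigmaFinite (P i)] [∀ i, SigmaFinite (Q i)],
      (∀ i, P i ≪ Q i) → Measure.pi P ≪ Measure.pi Q := by
  intro n
  induction n with
  | zero =>
    intro P Q _ _ _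
    rw [Measure.pi_of_empty P, Measure.pi_of_empty Q]
  | succ n ih =>
    intro P Q _ _ h
    have hP := (measurePreserving_piFinSuccAbove P 0).symm
    have hQ := (measurePreserving_piFinSuccAbove Q 0).symm
    rw [← hP.map_eq, ← hQ.map_eq]
    exact ((h 0).prod (ih fun j => h _)).map hP.measurable

theorem gaussPi_eq_pi {d : ℕ} (σ : ℝ) : ∃ v : NNReal, (v : ℝ) = σ ^ 2 ∧
    ∀ μ : Fin d → ℝ, gaussPi μ σ = Measure.pi fun i => ProbabilityTheory.gaussianReal (μ i) v :=
  ⟨⟨σ ^ 2, sq_nonneg σ⟩, rfl, fun _ => rfl⟩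

theorem gaussPi_absolutelyContinuous {d : ℕ} (μ₁ μ₂ : Fin d → ℝ) {σ : ℝ} (hσ : 0 < σ) :
    gaussPi μ₁ σ ≪ gaussPi μ₂ σ := by
  obtain ⟨v, hvσ, hv⟩ := gaussPi_eq_pi (d := d) σ
  have hv0 : v ≠ 0 := by
    rintro rfl
    exact (pow_pos hσ 2).ne hvσ
  rw [hv, hv]
  exact absolutelyContinuous_pi_fin fun i =>
    (ProbabilityTheory.gaussianReal_absolutelyContinuous _ hv0).trans
      (ProbabilityTheory.gaussianReal_absolutelyContinuous' _ hv0)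

instance isProbabilityMeasure_gaussPi {d : ℕ} (μ : Fin d → ℝ) (σ : ℝ) :
    IsProbabilityMeasure (gaussPi μ σ) := by
  obtain ⟨v, -, hv⟩ := gaussPi_eq_pi (d := d) σ
  rw [hv]
  infer_instance

section Duality

variable {X : Type*} [MeasurableSpace X]

theorem abs_measureReal_sub_le_one (P Q : Measure X) [IsProbabilityMeasure P]
    [IsProbabilityMeasure Q] (A : Set X) : |P.real A - Q.real A| ≤ 1 := by
  rw [abs_le]
  constructor <;>
    linarith [measureReal_nonneg (μ := P) (s := A), measureReal_nonneg (μ := Q) (s := A),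
      measureReal_le_one (μ := P) (s := A), measureReal_le_one (μ := Q) (s := A)]

theorem abs_measureReal_sub_le_TVdist (P Q : Measure X) [IsProbabilityMeasure P]
    [IsProbabilityMeasure Q] {A : Set X} (hA : MeasurableSet A) :
    |P.real A - Q.real A| ≤ TVdist P Q := by
  refine le_ciSup (f := fun A : {A : Set X // MeasurableSet A} =>
    |(P A).toReal - (Q A).toReal|) ⟨1, ?_⟩ ⟨A, hA⟩
  rintro _ ⟨A, rfl⟩
  exact abs_measureReal_sub_le_one P Q A

theorem integral_sub_integral_le_mul (P p : Measure X) [IsProbabilityMeasure P]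
    [IsProbabilityMeasure p] {r : ℝ} (hr : ∀ A, MeasurableSet A → P.real A - p.real A ≤ r)
    {g : X → ℝ} (hg : Measurable g) {a b : ℝ} (hab : a ≤ b)
    (hP : ∀ᵐ x ∂P, g x ∈ Icc a b) (hp : ∀ᵐ x ∂p, g x ∈ Icc a b) :
    ∫ x, g x ∂P - ∫ x, g x ∂p ≤ r * (b - a) := by
  have key : ∀ (q : Measure X) [IsProbabilityMeasure q], (∀ᵐ x ∂q, g x ∈ Icc a b) →
      ∫ x, g x ∂q = a + ∫ t in Ioc 0 (b - a), q.real {x | t ≤ g x - a} := by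
    intro q _ hq
    have hi : Integrable g q := Integrable.of_mem_Icc a b hg.aemeasurable hq
    rw [← Integrable.integral_eq_integral_Ioc_meas_le (f := fun x => g x - a) (M := b - a)
      (hi.sub (integrable_const a))]
    · rw [integral_sub hi (integrable_const a)]; simp
    · filter_upwards [hq] with x hx
      simpa using hx.1
    · filter_upwards [hq] with x hx
      simpa using hx.2
  have hint : ∀ (q : Measure X) [IsProbabilityMeasure q],
      IntegrableOn (fun t => q.real {x | t ≤ g x - a}) (Ioc 0 (b - a)) := by
    intro q _
    have hanti : Antitone (fun t => q.real {x | t ≤ g x - a}) := fun s t hst =>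
      measureReal_mono fun x (hx : t ≤ g x - a) => hst.trans hx
    refine Integrable.of_mem_Icc 0 1 hanti.measurable.aemeasurable (ae_of_all _ fun t => ?_)
    exact ⟨measureReal_nonneg, measureReal_le_one⟩
  rw [key P hP, key p hp, add_sub_add_left_eq_sub, ← integral_sub (hint P) (hint p)]
  calc _ ≤ ∫ t in Ioc 0 (b - a), r := by
        refine integral_mono ((hint P).sub (hint p)) (integrable_const r) fun t => ?_
        exact hr _ (measurableSet_le measurable_const (hg.sub_const a))
    _ = r * (b - a) := by
        simp [hab, mul_comm]

/-- Weak duality for the robust expectation over a total-variation ball. -/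
theorem integral_min_sub_le_integral (P p : Measure X) [IsProbabilityMeasure P]
    [IsProbabilityMeasure p] (hpP : p ≪ P)
    {r : ℝ} (hr : ∀ A, MeasurableSet A → P.real A - p.real A ≤ r)
    {V : X → ℝ} (hV : Measurable V) {m M η : ℝ} (hVm : ∀ᵐ x ∂P, m ≤ V x)
    (hVM : ∀ x, V x ≤ M) (hη : m ≤ η) :
    ∫ x, min (V x) η ∂P - r * (η - m) ≤ ∫ x, V x ∂p := by
  have hmem : ∀ᵐ x ∂P, min (V x) η ∈ Icc m η := by
    filter_upwards [hVm] with x hx using ⟨le_min hx hη, min_le_right _ _⟩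
  have h1 := integral_sub_integral_le_mul P p hr (hV.min measurable_const) hη hmem
    (hpP.ae_le hmem)
  have h2 : ∫ x, min (V x) η ∂p ≤ ∫ x, V x ∂p := by
    refine integral_mono_ae
      (Integrable.of_mem_Icc m η (hV.min measurable_const).aemeasurable (hpP.ae_le hmem))
      (Integrable.of_mem_Icc m M hV.aemeasurable ?_) (ae_of_all _ fun x => min_le_left _ _)
    filter_upwards [hpP.ae_le hVm] with x hx using ⟨hx, hVM x⟩
  linarith

theorem exists_upper_quantile (P : Measure X) [IsProbabilityMeasure P] {V : X → ℝ}
    (hV : Measurable V) {m M r : ℝ} (hr0 : 0 < r) (hr1 : r ≤ 1)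
    (hVm : ∀ᵐ x ∂P, m ≤ V x) (hVM : ∀ x, V x ≤ M) :
    ∃ η ∈ Icc m M, P.real {x | η < V x} ≤ r ∧ r ≤ P.real {x | η ≤ V x} := by
  set S : Set ℝ := {t | r ≤ P.real {x | t ≤ V x}}
  have hmS : m ∈ S := by
    have : P.real {x | m ≤ V x} = 1 := by
      rw [measureReal_def, show P {x | m ≤ V x} = 1 from by simpa using measure_congr (eventuallyEq_univ.2 hVm), ENNReal.toReal_one]
    simpa [S, this] using hr1
  have hub : ∀ t ∈ S, t ≤ M := by
    intro t ht
    by_contra! hlt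
    have : {x | t ≤ V x} = ∅ := by
      ext x; simpa using (hVM x).trans_lt hlt
    simp only [S, mem_ofPred_eq, this, measureReal_empty] at ht
    linarith
  have hbdd : BddAbove S := ⟨M, hub⟩
  have hlow : ∀ t, t < sSup S → t ∈ S := by
    intro t ht
    obtain ⟨s, hs, hts⟩ := exists_lt_of_lt_csSup ⟨m, hmS⟩ ht
    exact le_trans hs (measureReal_mono fun x (hx : s ≤ V x) => hts.le.trans hx)
  obtain ⟨u, hu_mono, hu_lt, hu⟩ := exists_seq_strictMono_tendsto (sSup S)
  obtain ⟨v, hv_anti, hv_lt, hv⟩ := exists_seq_strictAnti_tendsto (sSup S)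
  refine ⟨sSup S, ⟨le_csSup hbdd hmS, csSup_le ⟨m, hmS⟩ hub⟩, ?_, ?_⟩
  · have hset : {x | sSup S < V x} = ⋃ n, {x | v n ≤ V x} := by
      ext x
      simp only [mem_ofPred_eq, mem_iUnion]
      refine ⟨fun hx => ?_, fun ⟨n, hn⟩ => (hv_lt n).trans_le hn⟩
      obtain ⟨n, hn⟩ := (hv.eventually_lt_const hx).exists
      exact ⟨n, hn.le⟩
    have ht : Tendsto (fun n => P.real {x | v n ≤ V x}) atTop (nhds (P.real {x | sSup S < V x})) := by
      rw [hset]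
      refine (ENNReal.tendsto_toReal (measure_ne_top _ _)).comp
        (tendsto_measure_iUnion_atTop fun i j hij x hx => ?_)
      exact (hv_anti.antitone hij).trans hx
    refine le_of_tendsto' ht fun n => ?_
    by_contra! h
    exact (hv_lt n).not_ge (le_csSup hbdd h.le)
  · have hset : {x | sSup S ≤ V x} = ⋂ n, {x | u n ≤ V x} := by
      ext x
      simp only [mem_ofPred_eq, mem_iInter]
      exact ⟨fun hx n => (hu_lt n).le.trans hx, fun hx => le_of_tendsto' hu hx⟩
    have ht : Tendsto (fun n => P.real {x | u n ≤ V x}) atTop (nhds (P.real {x | sSup S ≤ V x})) := by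
      rw [hset]
      refine (ENNReal.tendsto_toReal (measure_ne_top _ _)).comp
        (tendsto_measure_iInter_atTop
          (fun i => (measurableSet_le measurable_const hV).nullMeasurableSet)
          (fun i j hij x hx => ?_) ⟨0, measure_ne_top _ _⟩)
      exact (hu_mono.monotone hij).trans hx
    exact ge_of_tendsto' ht fun n => hlow _ (hu_lt n)

/-- A weight trimming the top `r`-fraction of `V`. -/
theorem exists_trimming_weight (P : Measure X) [IsProbabilityMeasure P] {V : X → ℝ}
    (hV : Measurable V) {η r : ℝ} (h1 : P.real {x | η < V x} ≤ r)
    (h2 : r ≤ P.real {x | η ≤ V x}) :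
    ∃ w : X → ℝ, Measurable w ∧ (∀ x, w x ∈ Icc (0 : ℝ) 1) ∧ ∫ x, w x ∂P = r ∧
      ∀ x, (1 - w x) * V x = min (V x) η - η * w x := by
  have hgt : MeasurableSet {x | η < V x} := measurableSet_lt measurable_const hV
  have heq : MeasurableSet {x | V x = η} := hV (measurableSet_singleton η)
  have hsplit : P.real {x | η ≤ V x} = P.real {x | η < V x} + P.real {x | V x = η} := by
    rw [← measureReal_union _ heq]
    · congr 1; ext x; simp [le_iff_lt_or_eq, eq_comm]
    · rw [Set.disjoint_left]; intro x (hx : η < V x) (hx' : V x = η); exact hx.ne' hx'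
  obtain ⟨c, hc0, hc1, hc⟩ : ∃ c : ℝ, 0 ≤ c ∧ c ≤ 1 ∧
      P.real {x | η < V x} + c * P.real {x | V x = η} = r := by
    rcases (measureReal_nonneg (μ := P) (s := {x | V x = η})).eq_or_lt with h | h
    · exact ⟨0, le_rfl, zero_le_one, by rw [← h] at hsplit ⊢; linarith⟩
    · refine ⟨(r - P.real {x | η < V x}) / P.real {x | V x = η},
        div_nonneg (by linarith) h.le, (div_le_one h).2 (by linarith), ?_⟩
      rw [div_mul_cancel₀ _ h.ne']; ring
  refine ⟨fun x => {x | η < V x}.indicator (fun _ => 1) x +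
    {x | V x = η}.indicator (fun _ => c) x, ?_, ?_, ?_, ?_⟩
  · exact (measurable_const.indicator hgt).add (measurable_const.indicator heq)
  · intro x
    rcases lt_trichotomy η (V x) with h | h | h
    · simp [h, h.ne']
    · simp [← h, hc0, hc1]
    · simp [h.ne, not_lt.2 h.le]
  · rw [integral_add ((integrable_const _).indicator hgt) ((integrable_const _).indicator heq),
      integral_indicator_const _ hgt, integral_indicator_const _ heq]
    simp only [smul_eq_mul]; linarith
  · intro x
    rcases lt_trichotomy η (V x) with h | h | h
    · simp [h, h.ne', h.le]
    · simp [← h]; ring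
    · simp [h.ne, h.le, not_lt.2 h.le]

/-- Near-attainment in the dual formula for the robust expectation over a total-variation ball. -/
theorem exists_integral_le_dual (P : Measure X) [IsProbabilityMeasure P] {V : X → ℝ}
    (hV : Measurable V) {m M η r ε : ℝ} (hr0 : 0 ≤ r) (hVm : ∀ᵐ x ∂P, m ≤ V x)
    (hVM : ∀ x, V x ≤ M) (hε : 0 < P.real {x | V x < m + ε})
    (h1 : P.real {x | η < V x} ≤ r) (h2 : r ≤ P.real {x | η ≤ V x}) :
    ∃ p : Measure X, IsProbabilityMeasure p ∧ p ≪ P ∧ TVdist p P ≤ r ∧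
      ∫ x, V x ∂p ≤ ∫ x, min (V x) η ∂P - r * (η - (m + ε)) := by
  obtain ⟨w, hw, hw01, hwr, hwV⟩ := exists_trimming_weight P hV h1 h2
  set B := {x | V x < m + ε} with hBdef
  have hB : MeasurableSet B := measurableSet_lt hV measurable_const
  set k : ℝ := r / P.real B with hk
  have hk0 : 0 ≤ k := div_nonneg hr0 hε.le
  have hkB : k * P.real B = r := div_mul_cancel₀ _ hε.ne'
  have hwi : Integrable w P := Integrable.of_mem_Icc 0 1 hw.aemeasurable (ae_of_all _ hw01)
  have hwci : Integrable (fun x => 1 - w x) P := (integrable_const 1).sub hwi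
  have hbi : Integrable (B.indicator fun _ => k) P := (integrable_const k).indicator hB
  have hbm : Measurable (B.indicator fun _ => k) := measurable_const.indicator hB
  have hVi : Integrable V P := by
    refine Integrable.of_mem_Icc m M hV.aemeasurable ?_
    filter_upwards [hVm] with x hx using ⟨hx, hVM x⟩
  have hmini : Integrable (fun x => min (V x) η) P := hVi.inf (integrable_const η)
  set h : X → ℝ := fun x => (1 - w x) + B.indicator (fun _ => k) x with hh
  have hhm : Measurable h := (measurable_const.sub hw).add hbm
  have hh0 : ∀ x, 0 ≤ h x := fun x =>
    add_nonneg (by linarith [(hw01 x).2]) (indicator_nonneg (fun _ _ => hk0) x)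
  have hhi : Integrable h P := hwci.add hbi
  have hhint : ∫ x, h x ∂P = 1 := by
    rw [hh, integral_add hwci hbi, integral_sub (integrable_const 1) hwi,
      integral_indicator_const _ hB, hwr]
    simp only [integral_const, probReal_univ, smul_eq_mul]
    linarith
  have happ : ∀ A, MeasurableSet A →
      (P.withDensity fun x => ENNReal.ofReal (h x)).real A = ∫ x in A, h x ∂P := by
    intro A hA
    rw [measureReal_def, withDensity_apply _ hA,
      integral_eq_lintegral_of_nonneg_ae (ae_of_all _ hh0) hhm.aestronglyMeasurable]
  have hprob : IsProbabilityMeasure (P.withDensity fun x => ENNReal.ofReal (h x)) := by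
    constructor
    rw [withDensity_apply _ MeasurableSet.univ, Measure.restrict_univ,
      ← ofReal_integral_eq_lintegral_ofReal hhi (ae_of_all _ hh0), hhint, ENNReal.ofReal_one]
  refine ⟨_, hprob, withDensity_absolutelyContinuous _ _, ?_, ?_⟩
  · have : Nonempty {A : Set X // MeasurableSet A} := ⟨⟨∅, MeasurableSet.empty⟩⟩
    refine ciSup_le fun ⟨A, hA⟩ => ?_
    change |(P.withDensity fun x => ENNReal.ofReal (h x)).real A - P.real A| ≤ r
    have e : ∫ x in A, h x ∂P =
        P.real A - ∫ x in A, w x ∂P + ∫ x in A, B.indicator (fun _ => k) x ∂P := by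
      rw [hh, integral_add hwci.integrableOn hbi.integrableOn,
        integral_sub (integrable_const 1) hwi.integrableOn]
      simp
    have a1 : 0 ≤ ∫ x in A, w x ∂P := integral_nonneg fun x => (hw01 x).1
    have a2 : ∫ x in A, w x ∂P ≤ r := hwr ▸ setIntegral_le_integral hwi
      (ae_of_all _ fun x => (hw01 x).1)
    have hb0 : ∀ x, 0 ≤ B.indicator (fun _ => k) x := indicator_nonneg fun _ _ => hk0
    have a3 : 0 ≤ ∫ x in A, B.indicator (fun _ => k) x ∂P := integral_nonneg hb0
    have a4 : ∫ x in A, B.indicator (fun _ => k) x ∂P ≤ r := by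
      refine (setIntegral_le_integral hbi (ae_of_all _ hb0)).trans_eq ?_
      rw [integral_indicator_const _ hB, smul_eq_mul, mul_comm, hkB]
    rw [happ A hA, e, abs_le]
    constructor <;> linarith
  · rw [integral_withDensity_eq_integral_toReal_smul hhm.ennreal_ofReal
      (ae_of_all _ fun x => ENNReal.ofReal_lt_top)]
    have hle : ∀ x, (ENNReal.ofReal (h x)).toReal • V x ≤
        min (V x) η - η * w x + (m + ε) * B.indicator (fun _ => k) x := by
      intro x
      rw [ENNReal.toReal_ofReal (hh0 x), smul_eq_mul, hh, add_mul, hwV]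
      gcongr 1
      by_cases hx : x ∈ B
      · simp only [indicator_of_mem hx]
        rw [mul_comm]
        exact mul_le_mul_of_nonneg_right (le_of_lt hx) hk0
      · simp [indicator_of_notMem hx]
    have hri := (hmini.sub (hwi.const_mul η)).add (hbi.const_mul (m + ε))
    have hli : Integrable (fun x => (ENNReal.ofReal (h x)).toReal • V x) P := by
      have hBV : Integrable (fun x => k * B.indicator V x) P := (hVi.indicator hB).const_mul k
      refine ((hmini.sub (hwi.const_mul η)).add hBV).congr (ae_of_all _ fun x => ?_)
      beta_reduce
      rw [ENNReal.toReal_ofReal (hh0 x), smul_eq_mul, hh, add_mul, hwV]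
      by_cases hx : x ∈ B <;> simp [hx]
    refine (integral_mono hli hri hle).trans_eq ?_
    have e1 := integral_add (hmini.sub (hwi.const_mul η)) (hbi.const_mul (m + ε))
    have e2 := integral_sub hmini (hwi.const_mul η)
    simp only [Pi.add_apply, Pi.sub_apply] at e1 e2 ⊢
    rw [e1, e2, integral_const_mul, integral_const_mul, hwr, integral_indicator_const _ hB,
      smul_eq_mul, mul_comm (P.real B), hkB]
    ring

theorem exists_essential_infimum (P : Measure X) [IsProbabilityMeasure P] {V : X → ℝ} {M : ℝ}
    (hV0 : ∀ x, 0 ≤ V x) (hVM : ∀ x, V x ≤ M) :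
    ∃ m, 0 ≤ m ∧ (∀ᵐ x ∂P, m ≤ V x) ∧ ∀ ε > 0, 0 < P.real {x | V x < m + ε} := by
  have hb : IsBoundedUnder (· ≥ ·) (ae P) V := isBoundedUnder_of ⟨0, hV0⟩
  have hc : IsCoboundedUnder (· ≥ ·) (ae P) V :=
    (isBoundedUnder_of ⟨M, hVM⟩ : IsBoundedUnder (· ≤ ·) (ae P) V).isCoboundedUnder_ge
  refine ⟨essInf V P, le_essInf_of_ae_le 0 (ae_of_all _ hV0) hc, ae_essInf_le hb,
    fun ε hε => ?_⟩
  refine measureReal_nonneg.lt_of_ne' fun h0 => ?_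
  rw [measureReal_eq_zero_iff] at h0
  have : essInf V P + ε ≤ essInf V P := by
    refine le_essInf_of_ae_le _ ?_ hc
    rw [EventuallyLE, ae_iff]
    simpa using h0
  linarith

theorem robust_integral_le_add (P Q : Measure X) [IsProbabilityMeasure P]
    [IsProbabilityMeasure Q] (hQP : Q ≪ P) {V : X → ℝ} (hV : Measurable V)
    {M ρ S : ℝ} (hV0 : ∀ x, 0 ≤ V x) (hVM : ∀ x, V x ≤ M) (hρ : 0 < ρ)
    (hS : ∀ η ∈ Icc 0 M, |∫ x, max (η - V x) 0 ∂P - ∫ x, max (η - V x) 0 ∂Q| ≤ S) :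
    (⨅ p : {p : Measure X // IsProbabilityMeasure p ∧ p ≪ P ∧ TVdist p P ≤ ρ},
        ∫ x, V x ∂(p : Measure X)) ≤
      (⨅ p : {p : Measure X // IsProbabilityMeasure p ∧ p ≪ Q ∧ TVdist p Q ≤ ρ},
        ∫ x, V x ∂(p : Measure X)) + S := by
  obtain ⟨m, hm0, hmP, hmε⟩ := exists_essential_infimum P hV0 hVM
  have hr0 : 0 < min ρ 1 := lt_min hρ one_pos
  obtain ⟨η, hη, hη1, hη2⟩ := exists_upper_quantile P hV hr0 (min_le_right _ _) hmP hVM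
  have hmin : ∀ (q : Measure X) [IsProbabilityMeasure q],
      ∫ x, min (V x) η ∂q = η - ∫ x, max (η - V x) 0 ∂q := by
    intro q _
    have hi : Integrable (fun x => max (η - V x) 0) q := by
      refine Integrable.of_mem_Icc 0 (max η 0) (by fun_prop) (ae_of_all _ fun x => ?_)
      exact ⟨le_max_right _ _, max_le_max_right 0 (by linarith [hV0 x])⟩
    have : (fun x => min (V x) η) = fun x => η - max (η - V x) 0 := by
      funext x
      rcases le_total (V x) η with h | h
      · rw [min_eq_left h, max_eq_left (by linarith)]; ring
      · rw [min_eq_right h, max_eq_right (by linarith)]; ring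
    rw [this, integral_sub (integrable_const η) hi]
    simp
  have hQ_nonempty : Nonempty {p : Measure X // IsProbabilityMeasure p ∧ p ≪ Q ∧
      TVdist p Q ≤ ρ} := by
    refine ⟨⟨Q, inferInstance, Measure.AbsolutelyContinuous.rfl, ?_⟩⟩
    simp only [TVdist, sub_self, abs_zero]
    exact Real.iSup_le (fun _ => hρ.le) hρ.le
  have hbdd : BddBelow (range fun p : {p : Measure X // IsProbabilityMeasure p ∧ p ≪ P ∧
      TVdist p P ≤ ρ} => ∫ x, V x ∂(p : Measure X)) := by
    refine ⟨0, ?_⟩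
    rintro _ ⟨p, rfl⟩
    exact integral_nonneg hV0
  have upper : (⨅ p : {p : Measure X // IsProbabilityMeasure p ∧ p ≪ P ∧ TVdist p P ≤ ρ},
      ∫ x, V x ∂(p : Measure X)) ≤ ∫ x, min (V x) η ∂P - min ρ 1 * (η - m) := by
    refine le_of_forall_pos_le_add fun ε hε => ?_
    obtain ⟨p, hp, hpP, hTV, hle⟩ :=
      exists_integral_le_dual P hV hr0.le hmP hVM (hmε ε hε) hη1 hη2
    have h1 := ciInf_le hbdd ⟨p, hp, hpP, hTV.trans (min_le_left _ _)⟩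
    have h2 : min ρ 1 * ε ≤ 1 * ε := by gcongr; exact min_le_right _ _
    refine h1.trans (hle.trans ?_)
    linarith
  have lower : ∫ x, min (V x) η ∂Q - min ρ 1 * (η - m) ≤
      ⨅ p : {p : Measure X // IsProbabilityMeasure p ∧ p ≪ Q ∧ TVdist p Q ≤ ρ},
        ∫ x, V x ∂(p : Measure X) := by
    refine le_ciInf fun ⟨p, hp, hpQ, hTV⟩ => ?_
    refine integral_min_sub_le_integral Q p hpQ (fun A hA => ?_) hV (hQP.ae_le hmP) hVM hη.1
    have h1 := (abs_measureReal_sub_le_TVdist p Q hA).trans hTV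
    have h2 := abs_measureReal_sub_le_one p Q A
    exact le_min (by linarith [(abs_le.1 h1).1]) (by linarith [(abs_le.1 h2).1])
  have h := (abs_le.1 (hS η ⟨hm0.trans hη.1, hη.2⟩)).1
  rw [hmin] at upper lower
  linarith

end Duality

theorem stmt_19 {d : ℕ} (hd : 1 ≤ d) (σ : ℝ) (hσ : 0 < σ) (μ₁ μ₂ : Fin d → ℝ)
    (ρ : ℝ) (hρ : 0 < ρ) (γ : ℝ) (hγ : γ ∈ Set.Ioo (0 : ℝ) 1)
    (V : (Fin d → ℝ) → ℝ) (hV : Measurable V)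
    (hVb : ∀ x, V x ∈ Set.Icc (0 : ℝ) (1 / (1 - γ))) :
    |(⨅ p : {p : Measure (Fin d → ℝ) //
          IsProbabilityMeasure p ∧ p ≪ gaussPi μ₁ σ ∧ TVdist p (gaussPi μ₁ σ) ≤ ρ},
        ∫ x, V x ∂(p : Measure (Fin d → ℝ))) -
      ⨅ p : {p : Measure (Fin d → ℝ) //
          IsProbabilityMeasure p ∧ p ≪ gaussPi μ₂ σ ∧ TVdist p (gaussPi μ₂ σ) ≤ ρ},
        ∫ x, V x ∂(p : Measure (Fin d → ℝ))| ≤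
      ⨆ η : (Set.Icc (0 : ℝ) ((2 + ρ) / (ρ * (1 - γ)))),
        |(∫ x, max ((η : ℝ) - V x) 0 ∂(gaussPi μ₁ σ)) -
          ∫ x, max ((η : ℝ) - V x) 0 ∂(gaussPi μ₂ σ)| := by
  have hγ1 : 0 < 1 - γ := sub_pos.2 hγ.2
  have hM : 1 / (1 - γ) ≤ (2 + ρ) / (ρ * (1 - γ)) := by
    rw [div_le_div_iff₀ hγ1 (mul_pos hρ hγ1)]
    nlinarith
  have hV0 : ∀ x, 0 ≤ V x := fun x => (hVb x).1
  have hVM : ∀ x, V x ≤ 1 / (1 - γ) := fun x => (hVb x).2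
  have hrange : ∀ (q : Measure (Fin d → ℝ)) [IsProbabilityMeasure q] (η : ℝ), 0 ≤ η →
      ∫ x, max (η - V x) 0 ∂q ∈ Icc 0 η := by
    intro q _ η hη
    refine ⟨integral_nonneg fun x => le_max_right _ _, ?_⟩
    have hle : ∀ x, max (η - V x) 0 ≤ η := fun x => max_le (by linarith [hV0 x]) hη
    have hi : Integrable (fun x => max (η - V x) 0) q :=
      Integrable.of_mem_Icc 0 η (by fun_prop) (ae_of_all _ fun x => ⟨le_max_right _ _, hle x⟩)
    simpa using integral_mono hi (integrable_const η) hle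
  have hbdd : BddAbove (range fun η : (Set.Icc (0 : ℝ) ((2 + ρ) / (ρ * (1 - γ)))) =>
      |(∫ x, max ((η : ℝ) - V x) 0 ∂(gaussPi μ₁ σ)) -
        ∫ x, max ((η : ℝ) - V x) 0 ∂(gaussPi μ₂ σ)|) := by
    refine ⟨(2 + ρ) / (ρ * (1 - γ)), ?_⟩
    rintro _ ⟨⟨η, hη⟩, rfl⟩
    have h1 := hrange (gaussPi μ₁ σ) η hη.1
    have h2 := hrange (gaussPi μ₂ σ) η hη.1
    refine abs_le.2 ⟨?_, ?_⟩
    · linarith [h1.1, h2.2, hη.2]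
    · linarith [h2.1, h1.2, hη.2]
  have hS : ∀ η ∈ Icc 0 (1 / (1 - γ)), |∫ x, max (η - V x) 0 ∂(gaussPi μ₁ σ) -
      ∫ x, max (η - V x) 0 ∂(gaussPi μ₂ σ)| ≤ _ :=
    fun η hη => le_ciSup hbdd ⟨η, hη.1, hη.2.trans hM⟩
  rw [abs_sub_le_iff, sub_le_iff_le_add', sub_le_iff_le_add']
  exact ⟨robust_integral_le_add _ _ (gaussPi_absolutelyContinuous μ₂ μ₁ hσ) hV hV0 hVM hρ hS,
    robust_integral_le_add _ _ (gaussPi_absolutelyContinuous μ₁ μ₂ hσ) hV hV0 hVM hρ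
      fun η hη => (abs_sub_comm _ _).trans_le (hS η hη)⟩
end
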